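/- Let X₁, X₂ be independent zero-mean ℝ^t-valued random vectors with finite second moments such that X₁ + X₂ and X₁ − X₂ are independent. If additionally X₁ and X₂ are identically distributed (or more generally as in the Darmois–Skitovich setting), then X₁ and X₂ are Gaussian with the same covariance matrix. -/

import Mathlib

open MeasureTheory

open ProbabilityTheory Filter Topology in
/-- Two measures with the same first two moments have characteristic functions agreeing to
second order at the origin. -/
lemma charFun_taylor_aux {Ω : Type*} [MeasurableSpace Ω] {P : Measure Ω} [IsProbabilityMeasure P]
    {X : Ω → ℝ} (hX : AEMeasurable X P) (h2 : MemLp X 2 P) (h0 : ∫ ω, X ω ∂P = 0) :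
    (fun s : ℝ => charFun (P.map X) s - (1 - ((∫ ω, X ω ^ 2 ∂P : ℝ) : ℂ) * s ^ 2 / 2))
      =o[𝓝 0] fun s : ℝ => s ^ 2 := by
  have hmem : MemLp id 2 (P.map X) := (memLp_map_measure_iff (by fun_prop) hX).2 h2
  have hp : IsProbabilityMeasure (P.map X) := Measure.isProbabilityMeasure_map hX
  have ht := taylorWithinEval_charFun_two_zero hX hmem
  have h := taylor_isLittleO_univ (f := charFun (P.map X)) (n := 2) (x₀ := 0)
    (contDiff_charFun hmem)
  simp_rw [ht, h0] at h
  simpa using h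

/-- Four-fold product comparison. -/
lemma norm_prod_four_aux {a b : ℂ} (ha : ‖a‖ ≤ 1) (hb : ‖b‖ ≤ 1) {c d : ℂ}
    (hd : ‖d‖ ≤ 1) (h : ‖c - d‖ ≤ ‖a - b‖) :
    ‖a * a * (a * c) - b * b * (b * d)‖ ≤ 4 * ‖a - b‖ := by
  have key : ∀ x y z w : ℂ, ‖x‖ ≤ 1 → ‖w‖ ≤ 1 → ‖x * z - y * w‖ ≤ ‖z - w‖ + ‖x - y‖ := by
    intro x y z w hx hw
    have : x * z - y * w = x * (z - w) + (x - y) * w := by ring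
    rw [this]
    refine (norm_add_le _ _).trans ?_
    rw [norm_mul, norm_mul]
    gcongr
    · exact mul_le_of_le_one_left (norm_nonneg _) hx
    · exact mul_le_of_le_one_right (norm_nonneg _) hw
  have m : ∀ x y : ℂ, ‖x‖ ≤ 1 → ‖y‖ ≤ 1 → ‖x * y‖ ≤ 1 := by
    intro x y hx hy
    rw [norm_mul]
    exact mul_le_one₀ hx (norm_nonneg _) hy
  have h1 := key (a * a) (b * b) (a * c) (b * d) (m _ _ ha ha) (m _ _ hb hd)
  have h2 := key a b a b ha hb
  have h3 := key a b c d ha hd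
  linarith

open ProbabilityTheory Filter Topology in
/-- One-dimensional Bernstein theorem, i.i.d. case. -/
lemma bernstein_real_aux {Ω : Type*} [MeasurableSpace Ω] {P : Measure Ω} [IsProbabilityMeasure P]
    {U V : Ω → ℝ} (hU : Measurable U) (hV : Measurable V) (hUV : IndepFun U V P)
    (hid : P.map U = P.map V) (h0 : ∫ ω, U ω ∂P = 0) (h2 : MemLp U 2 P)
    (hsd : IndepFun (fun ω => U ω + V ω) (fun ω => U ω - V ω) P) :
    P.map U = gaussianReal 0 (Real.toNNReal (∫ ω, U ω ^ 2 ∂P)) := by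
  set v : NNReal := Real.toNNReal (∫ ω, U ω ^ 2 ∂P) with hv
  have hvr : (v : ℝ) = ∫ ω, U ω ^ 2 ∂P :=
    Real.coe_toNNReal _ (integral_nonneg fun ω => sq_nonneg _)
  have hp : IsProbabilityMeasure (P.map U) := Measure.isProbabilityMeasure_map hU.aemeasurable
  set φ := charFun (P.map U) with hφ
  set ψ := charFun (gaussianReal 0 v) with hψ
  -- functional equations
  have hVneg : ∀ s, charFun (P.map (fun ω => - V ω)) s = φ (-s) := by
    intro s
    have := charFun_map_mul_comp (μ := P) hV.aemeasurable (-1) s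
    simpa [hφ, hid] using this
  have fφ : ∀ s, φ (2 * s) = φ s * φ s * (φ s * φ (-s)) := by
    intro s
    have e1 := congrFun (hUV.charFun_map_fun_add_eq_mul hU.aemeasurable hV.aemeasurable) s
    have hUVneg : IndepFun U (fun ω => - V ω) P := hUV.comp measurable_id measurable_neg
    have e2 := congrFun (hUVneg.charFun_map_fun_add_eq_mul (Y := fun ω => - V ω) hU.aemeasurable
      hV.neg.aemeasurable) s
    have e3 := congrFun (hsd.charFun_map_fun_add_eq_mul (by fun_prop) (by fun_prop)) s
    have e4 := charFun_map_mul_comp (μ := P) hU.aemeasurable 2 s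
    have e5 : (fun ω => U ω + V ω + (U ω - V ω)) = fun ω => 2 * U ω := by
      funext ω; ring
    rw [e5, e4] at e3
    simp only [Pi.mul_apply, hVneg, ← sub_eq_add_neg] at e1 e2 e3
    rw [e1, e2, ← hid] at e3
    exact e3
  have fψ : ∀ s, ψ (2 * s) = ψ s * ψ s * (ψ s * ψ (-s)) := by
    intro s
    simp only [hψ, charFun_gaussianReal, ← Complex.exp_add]
    congr 1
    push_cast
    ring
  have hφ1 : ∀ s, ‖φ s‖ ≤ 1 := fun s => norm_charFun_le_one s
  have hψ1 : ∀ s, ‖ψ s‖ ≤ 1 := fun s => norm_charFun_le_one s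
  have hD : ∀ s, ‖φ (2 * s) - ψ (2 * s)‖ ≤ 4 * ‖φ s - ψ s‖ := by
    intro s
    rw [fφ, fψ]
    refine norm_prod_four_aux (hφ1 s) (hψ1 s) (hψ1 _) ?_
    rw [hφ, hψ, charFun_neg, charFun_neg, ← map_sub, RCLike.norm_conj]
  have hDn : ∀ (n : ℕ) s, ‖φ s - ψ s‖ ≤ 4 ^ n * ‖φ (s / 2 ^ n) - ψ (s / 2 ^ n)‖ := by
    intro n s
    induction n with
    | zero => simp
    | succ k ih =>
      have := hD (s / 2 ^ (k + 1))
      have e : 2 * (s / 2 ^ (k + 1)) = s / 2 ^ k := by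
        rw [pow_succ]; field_simp
      rw [e] at this
      calc _ ≤ _ := ih
        _ ≤ 4 ^ k * (4 * ‖φ (s / 2 ^ (k + 1)) - ψ (s / 2 ^ (k + 1))‖) := by gcongr
        _ = _ := by ring
  -- second-order agreement at the origin
  have tφ := charFun_taylor_aux hU.aemeasurable h2 h0
  have tψ := charFun_taylor_aux (P := gaussianReal 0 v) (X := id) aemeasurable_id
    (memLp_id_gaussianReal 2) (by simp [integral_id_gaussianReal])
  have hvar : ∫ x, (id x : ℝ) ^ 2 ∂(gaussianReal 0 v) = v := by
    have h := variance_fun_id_gaussianReal (μ := 0) (v := v)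
    rw [variance_eq_integral (by fun_prop)] at h
    simpa using h
  rw [hvar, Measure.map_id, hvr] at tψ
  have hsub : (fun s => φ s - ψ s) =o[𝓝 0] fun s : ℝ => s ^ 2 := by
    have := tφ.sub tψ
    simpa using this
  apply Measure.ext_of_charFun
  funext s
  change φ s = ψ s
  rw [← sub_eq_zero, ← norm_eq_zero]
  refine le_antisymm ?_ (norm_nonneg _)
  refine le_of_forall_pos_le_add fun ε hε => ?_
  have hlim : Tendsto (fun n : ℕ => s / 2 ^ n) atTop (𝓝 0) := by
    have := (tendsto_pow_atTop_nhds_zero_of_lt_one (r := (1 / 2 : ℝ)) (by norm_num)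
      (by norm_num)).const_mul s
    simpa [div_eq_mul_inv] using this
  have hc : 0 < ε / (s ^ 2 + 1) := by positivity
  obtain ⟨n, hn⟩ := (hlim.eventually (hsub.def hc)).exists
  calc ‖φ s - ψ s‖ ≤ 4 ^ n * ‖φ (s / 2 ^ n) - ψ (s / 2 ^ n)‖ := hDn n s
    _ ≤ 4 ^ n * (ε / (s ^ 2 + 1) * ‖(s / 2 ^ n) ^ 2‖) := by gcongr
    _ = ε * (s ^ 2 / (s ^ 2 + 1)) := by
      rw [Real.norm_of_nonneg (by positivity), div_pow, ← pow_mul, mul_comm n 2, pow_mul]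
      norm_num
      field_simp
    _ ≤ ε * 1 := by
      gcongr
      rw [div_le_one (by positivity)]
      linarith
    _ = 0 + ε := by ring

/-- Vector Bernstein/Darmois–Skitovich characterization: if `X₁, X₂` are independent,
identically distributed, zero-mean random vectors with finite second moments such that
`X₁ + X₂` and `X₁ − X₂` are independent, then `X₁` and `X₂` are Gaussian with the same
covariance matrix (i.e., every linear functional of them has a centered real Gaussian law
with the variance given by a common covariance matrix `K`). -/
theorem bernstein_gaussian_characterization
    {Ω : Type*} [MeasurableSpace Ω] (μ : Measure Ω) [IsProbabilityMeasure μ]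
    (t : ℕ) (X₁ X₂ : Ω → Fin t → ℝ)
    (hm1 : Measurable X₁) (hm2 : Measurable X₂)
    (hindep : ProbabilityTheory.IndepFun X₁ X₂ μ)
    (hid : μ.map X₁ = μ.map X₂)
    (hmean : ∀ i, ∫ ω, X₁ ω i ∂μ = 0)
    (hint : ∀ i j, Integrable (fun ω => X₁ ω i * X₁ ω j) μ)
    (hsumdiff : ProbabilityTheory.IndepFun (fun ω => X₁ ω + X₂ ω)
        (fun ω => X₁ ω - X₂ ω) μ) :
    ∃ K : Matrix (Fin t) (Fin t) ℝ,
      (∀ i j, ∫ ω, X₁ ω i * X₁ ω j ∂μ = K i j) ∧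
      (∀ i j, ∫ ω, X₂ ω i * X₂ ω j ∂μ = K i j) ∧
      (∀ l : Fin t → ℝ,
        μ.map (fun ω => ∑ i, l i * X₁ ω i)
          = ProbabilityTheory.gaussianReal 0
              (Real.toNNReal (∑ i, ∑ j, l i * K i j * l j)) ∧
        μ.map (fun ω => ∑ i, l i * X₂ ω i)
          = ProbabilityTheory.gaussianReal 0
              (Real.toNNReal (∑ i, ∑ j, l i * K i j * l j))) := by
  have hX2 : ∀ i, MemLp (fun ω => X₁ ω i) 2 μ := by
    intro i
    rw [memLp_two_iff_integrable_sq (by fun_prop)]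
    simpa [sq] using hint i i
  have hX1 : ∀ i, Integrable (fun ω => X₁ ω i) μ := fun i => (hX2 i).integrable (by norm_num)
  refine ⟨fun i j => ∫ ω, X₁ ω i * X₁ ω j ∂μ, fun i j => rfl, fun i j => ?_, fun l => ?_⟩
  · have hf : ∀ ν : Measure (Fin t → ℝ),
        AEStronglyMeasurable (fun x : Fin t → ℝ => x i * x j) ν := fun ν => by fun_prop
    have e1 := integral_map hm1.aemeasurable (hf (μ.map X₁))
    have e2 := integral_map hm2.aemeasurable (hf (μ.map X₂))
    exact e2.symm.trans ((by rw [hid]) : _ = _) |>.trans e1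
  · have hL : Measurable (fun x : Fin t → ℝ => ∑ i, l i * x i) := by fun_prop
    have hmapeq : μ.map (fun ω => ∑ i, l i * X₁ ω i) = μ.map (fun ω => ∑ i, l i * X₂ ω i) := by
      have e1 := Measure.map_map (μ := μ) hL hm1
      have e2 := Measure.map_map (μ := μ) hL hm2
      rw [hid, e2] at e1
      exact e1.symm
    have hmeas1 : Measurable (fun ω => ∑ i, l i * X₁ ω i) := hL.comp hm1
    have hmeas2 : Measurable (fun ω => ∑ i, l i * X₂ ω i) := hL.comp hm2
    have hUV : ProbabilityTheory.IndepFun (fun ω => ∑ i, l i * X₁ ω i)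
        (fun ω => ∑ i, l i * X₂ ω i) μ := hindep.comp hL hL
    have hsd : ProbabilityTheory.IndepFun
        (fun ω => ∑ i, l i * X₁ ω i + ∑ i, l i * X₂ ω i)
        (fun ω => ∑ i, l i * X₁ ω i - ∑ i, l i * X₂ ω i) μ := by
      have h := hsumdiff.comp hL hL
      convert h using 1
      · funext ω
        simp [mul_add, Finset.sum_add_distrib]
      · funext ω
        simp [mul_sub, Finset.sum_sub_distrib]
    have h0 : ∫ ω, ∑ i, l i * X₁ ω i ∂μ = 0 := by
      rw [integral_finsetSum _ fun i _ => (hX1 i).const_mul (l i)]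
      simp [integral_const_mul, hmean]
    have h2 : MemLp (fun ω => ∑ i, l i * X₁ ω i) 2 μ :=
      memLp_finsetSum _ fun i _ => (hX2 i).const_mul (l i)
    have hvar : ∫ ω, (∑ i, l i * X₁ ω i) ^ 2 ∂μ
        = ∑ i, ∑ j, l i * (∫ ω, X₁ ω i * X₁ ω j ∂μ) * l j := by
      have e : ∀ ω, (∑ i, l i * X₁ ω i) ^ 2
          = ∑ i, ∑ j, l i * (X₁ ω i * X₁ ω j) * l j := by
        intro ω
        rw [sq, Finset.sum_mul_sum]
        refine Finset.sum_congr rfl fun i _ => Finset.sum_congr rfl fun j _ => by ring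
      simp_rw [e]
      have hij : ∀ i j, Integrable (fun ω => l i * (X₁ ω i * X₁ ω j) * l j) μ :=
        fun i j => ((hint i j).const_mul _).mul_const _
      rw [integral_finsetSum _ fun i _ => integrable_finsetSum _ fun j _ => hij i j]
      refine Finset.sum_congr rfl fun i _ => ?_
      rw [integral_finsetSum _ fun j _ => hij i j]
      refine Finset.sum_congr rfl fun j _ => ?_
      rw [integral_mul_const, integral_const_mul]
    have main := bernstein_real_aux hmeas1 hmeas2 hUV hmapeq h0 h2 hsd
    rw [hvar] at main
    exact ⟨main, hmapeq ▸ main⟩
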